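/- Let P be a CP (resp. a CP-ideal) of L, let A be a Lie ideal of L contained in P, and let f ∈ L* be regular with f(A) = 0. Then the image P/A of P in the quotient Lie algebra L/A is a CP (resp. a CP-ideal) of L/A, and i(L/A) = i(L) − dim A. -/

import Mathlib

open Module

noncomputable section

variable (k : Type*) [Field k]

/-- `L(f) = {x ∈ L | f ⁅x, y⁆ = 0 for all y ∈ L}`. -/
def lieStab (L : Type*) [LieRing L] [LieAlgebra k L] (f : Module.Dual k L) :
    Submodule k L where
  carrier := {x | ∀ y : L, f ⁅x, y⁆ = 0}
  add_mem' := fun {a b} ha hb y => by rw [add_lie, map_add, ha y, hb y, add_zero]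
  zero_mem' := fun y => by rw [zero_lie, map_zero]
  smul_mem' := fun c a ha y => by rw [smul_lie, map_smul, ha y, smul_zero]

/-- The index `i(L)`, the minimum of `dim L(f)` over all `f ∈ L*`. -/
def lieIndex (L : Type*) [LieRing L] [LieAlgebra k L] : ℕ :=
  ⨅ f : Module.Dual k L, finrank k (lieStab k L f)

/-- `f ∈ L*` is regular if `dim L(f) = i(L)`. -/
def LieIsRegular (L : Type*) [LieRing L] [LieAlgebra k L] (f : Module.Dual k L) : Prop :=
  finrank k (lieStab k L f) = lieIndex k L

/-- A commutative polarization of `L`: an abelian Lie subalgebra `P` with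
`2 dim P = dim L + i(L)`. -/
def IsCP (L : Type*) [LieRing L] [LieAlgebra k L] (P : LieSubalgebra k L) : Prop :=
  IsLieAbelian ↥P ∧ 2 * finrank k ↥P = finrank k L + lieIndex k L

/-- A CP-ideal of `L`: a CP which is also a Lie ideal of `L`. -/
def IsCPIdeal (L : Type*) [LieRing L] [LieAlgebra k L] (P : LieSubalgebra k L) : Prop :=
  IsCP k L P ∧ ∀ x y : L, y ∈ P → ⁅x, y⁆ ∈ P

/-- `L` is square integrable if `i(L) = dim Z(L)`. -/
def SquareIntegrable (L : Type*) [LieRing L] [LieAlgebra k L] : Prop :=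
  lieIndex k L = finrank k ↥(LieAlgebra.center k L)


/-- The quotient map `L → L ⧸ A` as a morphism of Lie algebras. -/
def lieQuotMk {k L : Type*} [Field k] [LieRing L] [LieAlgebra k L] (A : LieIdeal k L) :
    L →ₗ⁅k⁆ L ⧸ A :=
  { (LieSubmodule.Quotient.mk' A).toLinearMap with
    map_lie' := fun {_ _} => rfl }

/-- The alternating form `(x, y) ↦ f ⁅x, y⁆` attached to a linear form `f`. -/
def lieForm {L : Type*} [LieRing L] [LieAlgebra k L] (f : Module.Dual k L) :
    LinearMap.BilinForm k L :=
  (LieModule.toEnd k L L : L →ₗ[k] L →ₗ[k] L).compr₂ f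

theorem lieForm_apply {L : Type*} [LieRing L] [LieAlgebra k L] (f : Module.Dual k L)
    (x y : L) : lieForm k f x y = f ⁅x, y⁆ := rfl

theorem lieForm_isRefl {L : Type*} [LieRing L] [LieAlgebra k L] (f : Module.Dual k L) :
    (lieForm k f).IsRefl := by
  intro x y h
  rw [lieForm_apply] at h ⊢
  rw [← lie_skew, map_neg, h, neg_zero]

/-- An abelian subalgebra is totally isotropic for every form `f ⁅x, y⁆`, whence
`2 dim P ≤ dim L + dim L(f)`. -/
theorem two_mul_finrank_le_of_isLieAbelian {L : Type*} [LieRing L] [LieAlgebra k L]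
    [FiniteDimensional k L] (P : LieSubalgebra k L) [IsLieAbelian P] (f : Module.Dual k L) :
    2 * finrank k P ≤ finrank k L + finrank k (lieStab k L f) := by
  have horth : P.toSubmodule ≤ (lieForm k f).orthogonal P.toSubmodule := by
    intro x hx y hy
    have h : ⁅y, x⁆ = 0 := congrArg Subtype.val (trivial_lie_zero P P ⟨y, hy⟩ ⟨x, hx⟩)
    rw [lieForm_apply, h, map_zero]
  have hrad : P.toSubmodule ⊓ (lieForm k f).orthogonal ⊤ ≤ lieStab k L f :=
    fun x hx y => lieForm_isRefl k f y x (hx.2 y trivial)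
  have h₁ := LinearMap.BilinForm.finrank_add_finrank_orthogonal
    (lieForm_isRefl k f) P.toSubmodule
  have h₂ := Submodule.finrank_mono horth
  have h₃ := Submodule.finrank_mono hrad
  have h₄ : finrank k P.toSubmodule = finrank k P := rfl
  omega

theorem lieIndex_le (L : Type*) [LieRing L] [LieAlgebra k L] (f : Module.Dual k L) :
    lieIndex k L ≤ finrank k (lieStab k L f) :=
  ciInf_le (OrderBot.bddBelow _) f

theorem exists_lieIsRegular (L : Type*) [LieRing L] [LieAlgebra k L] :
    ∃ f : Module.Dual k L, LieIsRegular k L f :=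
  Set.mem_range.mp (Nat.sInf_mem (Set.range_nonempty _))

/-- Linear subspaces containing `A` drop in dimension by `dim A` in `L ⧸ A`. -/
theorem finrank_map_lieQuotMk_add {k L : Type*} [Field k] [LieRing L] [LieAlgebra k L]
    [FiniteDimensional k L] (A : LieIdeal k L) (W : Submodule k L) (hAW : A.toSubmodule ≤ W) :
    finrank k (W.map (lieQuotMk A).toLinearMap) + finrank k A = finrank k W := by
  have hker : LinearMap.ker (lieQuotMk A).toLinearMap = A.toSubmodule := A.toSubmodule.ker_mkQ
  have h := ((lieQuotMk A).toLinearMap.domRestrict W).finrank_range_add_finrank_ker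
  rw [LinearMap.range_domRestrict, LinearMap.ker_domRestrict, hker,
    (Submodule.comapSubtypeEquivOfLe hAW).finrank_eq] at h
  exact h

/-- If `f` vanishes on `A`, the stabilizer of the form induced by `f` on `L ⧸ A` is `L(f)/A`. -/
theorem exists_lieStab_quotient_eq_map {k L : Type*} [Field k] [LieRing L] [LieAlgebra k L]
    (A : LieIdeal k L) (f : Module.Dual k L) (hfA : ∀ a : L, a ∈ A → f a = 0) :
    ∃ g : Module.Dual k (L ⧸ A),
      lieStab k (L ⧸ A) g = (lieStab k L f).map (lieQuotMk A).toLinearMap := by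
  have hsurj : Function.Surjective (lieQuotMk A) := Submodule.Quotient.mk_surjective _
  let g : Module.Dual k (L ⧸ A) := A.toSubmodule.liftQ f hfA
  have hg : ∀ x y : L, g ⁅lieQuotMk A x, lieQuotMk A y⁆ = f ⁅x, y⁆ := fun _ _ => rfl
  refine ⟨g, le_antisymm ?_ ?_⟩
  · intro z hz
    obtain ⟨x, rfl⟩ := hsurj z
    exact ⟨x, fun y => (hg x y).symm.trans (hz _), rfl⟩
  · rintro _ ⟨x, hx, rfl⟩ z
    obtain ⟨y, rfl⟩ := hsurj z
    exact (hg x y).trans (hx y)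

theorem isLieAbelian_map {k L M : Type*} [Field k] [LieRing L] [LieAlgebra k L] [LieRing M]
    [LieAlgebra k M] (φ : L →ₗ⁅k⁆ M) (P : LieSubalgebra k L) [IsLieAbelian P] :
    IsLieAbelian (P.map φ) := by
  refine ⟨?_⟩
  rintro ⟨_, x, hx, rfl⟩ ⟨_, y, hy, rfl⟩
  have h : ⁅x, y⁆ = 0 := congrArg Subtype.val (trivial_lie_zero P P ⟨x, hx⟩ ⟨y, hy⟩)
  apply Subtype.ext
  change ⁅φ x, φ y⁆ = 0
  rw [← LieHom.map_lie, h, map_zero]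

/-- **Lemma 1.13.** Let `P` be a CP of `L`, `A ⊆ P` a Lie ideal of `L` and `f ∈ L*` regular
with `f(A) = 0`.  Then `P/A` is a CP of `L/A` (a CP-ideal if `P` is a CP-ideal), and
`i(L/A) = i(L) - dim A`. -/
theorem cp_quotient {k L : Type*} [Field k] [CharZero k] [LieRing L]
    [LieAlgebra k L] [FiniteDimensional k L] (P : LieSubalgebra k L) (A : LieIdeal k L)
    (hAP : ∀ a : L, a ∈ A → a ∈ P) (f : Module.Dual k L) (hf : LieIsRegular k L f)
    (hfA : ∀ a : L, a ∈ A → f a = 0) (hcp : IsCP k L P) :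
    IsCP k (L ⧸ A) (P.map (lieQuotMk A)) ∧
    lieIndex k (L ⧸ A) + finrank k ↥A = lieIndex k L ∧
    ((∀ x y : L, y ∈ P → ⁅x, y⁆ ∈ P) → IsCPIdeal k (L ⧸ A) (P.map (lieQuotMk A))) := by
  have hab : IsLieAbelian P := hcp.1
  have habQ : IsLieAbelian (P.map (lieQuotMk A)) := isLieAbelian_map _ P
  have hsurj : Function.Surjective (lieQuotMk A) := Submodule.Quotient.mk_surjective _
  have hP : finrank k (P.map (lieQuotMk A)) + finrank k A = finrank k P :=
    finrank_map_lieQuotMk_add A P.toSubmodule hAP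
  have hL : finrank k (L ⧸ A) + finrank k A = finrank k L :=
    A.toSubmodule.finrank_quotient_add_finrank
  have hAstab : A.toSubmodule ≤ lieStab k L f :=
    fun a ha y => hfA _ (lie_mem_left k L A a y ha)
  have hS := finrank_map_lieQuotMk_add A (lieStab k L f) hAstab
  obtain ⟨g, hg⟩ := exists_lieStab_quotient_eq_map A f hfA
  have hle := lieIndex_le k (L ⧸ A) g
  rw [hg] at hle
  obtain ⟨g', hg'⟩ := exists_lieIsRegular k (L ⧸ A)
  have hge := two_mul_finrank_le_of_isLieAbelian k (P.map (lieQuotMk A)) g'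
  have hdim := hcp.2
  unfold LieIsRegular at hf hg'
  have hcpQ : IsCP k (L ⧸ A) (P.map (lieQuotMk A)) := ⟨habQ, by omega⟩
  refine ⟨hcpQ, by omega, fun hideal => ⟨hcpQ, ?_⟩⟩
  rintro z _ ⟨y, hy, rfl⟩
  obtain ⟨x, rfl⟩ := hsurj z
  exact ⟨⁅x, y⁆, hideal x y hy, rfl⟩

end
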